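/- arXiv:2003.13169 — 4 statements merged into one kernel-verified Lean document; each statement's English description precedes it below -/
import Mathlib

section
/- For θ ∈ ℝ set P_θ = span(cos θ·e₁ + sin θ·e₅, cos θ·(√3e₂+√5e₆) − sin θ·(√5e₂−√3e₆), cos θ·(√3e₃−√5e₇) + sin θ·(√5e₃+√3e₇)). Then: (i) every P_θ is a 3-dimensional subspace invariant under the substitution action of every element of Tet; (ii) every 3-dimensional Tet-invariant subspace of H₃ equals P_θ for some θ; (iii) P_θ is associative if and only if θ is an integer multiple of π/3; (iv) for θ an integer multiple of π/3, the SO(3)-stabiliser of P_θ strictly contains Tet; consequently no 3-dimensional associative subspace of H₃ has SO(3)-stabiliser equal to Tet. -/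
noncomputable section

open MvPolynomial Matrix

/-- The polynomial ring `ℝ[x,y,z]`. -/
abbrev P3 := MvPolynomial (Fin 3) ℝ

/-- `SO(3)`, realised as a set of real 3×3 matrices. -/
def SO3 : Set (Matrix (Fin 3) (Fin 3) ℝ) := {A | A * Aᵀ = 1 ∧ A.det = 1}

/-- The substitution action of a matrix `A` on polynomials: `(A · p)(w) = p (A⁻¹ w)`,
i.e. the variable `Xᵢ` is replaced by `∑ⱼ (A⁻¹)ᵢⱼ Xⱼ`. -/
def sAct (A : Matrix (Fin 3) (Fin 3) ℝ) (p : P3) : P3 :=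
  aeval (fun i => ∑ j, A⁻¹ i j • (X j : P3)) p

/-- The Laplace operator on polynomials in three variables. -/
def lap : P3 →ₗ[ℝ] P3 :=
  ∑ i : Fin 3, ((pderiv i).toLinearMap ∘ₗ (pderiv i).toLinearMap)

/-- `H₃`: the space of harmonic homogeneous cubic polynomials in `x, y, z`. -/
def H3 : Submodule ℝ P3 :=
  homogeneousSubmodule (Fin 3) ℝ 3 ⊓ LinearMap.ker lap

/-- The orthonormal basis `e₁, …, e₇` of `H₃` (with `x = X 0`, `y = X 1`, `z = X 2`). -/
def eH : Fin 7 → P3 :=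
  ![(1 / 5 : ℝ) • (X 0 * (2 * X 0 ^ 2 - 3 * X 1 ^ 2 - 3 * X 2 ^ 2)),
    (Real.sqrt 6 / 10) • (X 2 * (4 * X 0 ^ 2 - X 1 ^ 2 - X 2 ^ 2)),
    (Real.sqrt 6 / 10) • (X 1 * (4 * X 0 ^ 2 - X 1 ^ 2 - X 2 ^ 2)),
    (2 * Real.sqrt 15 / 5) • (X 0 * X 1 * X 2),
    (Real.sqrt 15 / 5) • (X 0 * (X 1 ^ 2 - X 2 ^ 2)),
    (Real.sqrt 10 / 10) • (X 2 * (3 * X 1 ^ 2 - X 2 ^ 2)),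
    (Real.sqrt 10 / 10) • (X 1 * (X 1 ^ 2 - 3 * X 2 ^ 2))]

/-- The identification of `ℝ⁷` (coordinates) with `H₃`, via the basis `e₁, …, e₇`. -/
def iotaH (v : Fin 7 → ℝ) : P3 := ∑ i, v i • eH i

/-- The subset of `H₃` corresponding to a coordinate subspace `E ⊆ ℝ⁷`. -/
def polySet (E : Submodule ℝ (Fin 7 → ℝ)) : Set P3 := iotaH '' (E : Set (Fin 7 → ℝ))

/-- The inner product of `H₃` making `e₁, …, e₇` orthonormal, in coordinates. -/
def dot7 (u v : Fin 7 → ℝ) : ℝ := ∑ i, u i * v i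

/-- The 3×3 minor determinant `(eⁱ ∧ eʲ ∧ eᵏ) (u, v, w)`. -/
def triD (u v w : Fin 7 → ℝ) (i j k : Fin 7) : ℝ :=
  Matrix.det !![u i, u j, u k; v i, v j, v k; w i, w j, w k]

/-- The 3-form `φ₀ = e¹²³ + e¹⁴⁵ − e¹⁶⁷ + e²⁴⁶ + e²⁵⁷ + e³⁴⁷ − e³⁵⁶`, in coordinates
(indices shifted by one: `eᵢ = e (i-1)`). -/
def phi0 (u v w : Fin 7 → ℝ) : ℝ :=
  triD u v w 0 1 2 + triD u v w 0 3 4 - triD u v w 0 5 6 + triD u v w 1 3 5 +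
    triD u v w 1 4 6 + triD u v w 2 3 6 - triD u v w 2 4 5

/-- A 3-dimensional subspace `E` of `H₃` (in coordinates) is associative if it has an
orthonormal basis `(u, v, w)` with `φ₀ (u, v, w) = ±1`. -/
def IsAssocSubspace (E : Submodule ℝ (Fin 7 → ℝ)) : Prop :=
  ∃ u v w : Fin 7 → ℝ, u ∈ E ∧ v ∈ E ∧ w ∈ E ∧
    dot7 u u = 1 ∧ dot7 v v = 1 ∧ dot7 w w = 1 ∧
    dot7 u v = 0 ∧ dot7 u w = 0 ∧ dot7 v w = 0 ∧
    Submodule.span ℝ {u, v, w} = E ∧ (phi0 u v w = 1 ∨ phi0 u v w = -1)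

/-- The subspace `E ⊆ H₃` is invariant under the substitution action of `A`: `A · E = E`. -/
def InvUnder (A : Matrix (Fin 3) (Fin 3) ℝ) (E : Submodule ℝ (Fin 7 → ℝ)) : Prop :=
  sAct A '' polySet E = polySet E

/-- The `SO(3)`-stabiliser of a subspace `E ⊆ H₃`: `{A ∈ SO(3) | A · E = E}`. -/
def stabSO3 (E : Submodule ℝ (Fin 7 → ℝ)) : Set (Matrix (Fin 3) (Fin 3) ℝ) :=
  {A | A ∈ SO3 ∧ InvUnder A E}

/-- The subset `S` of a monoid is a subgroup isomorphic to the group `G`. -/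
def SetIsoGroup {M : Type*} [Monoid M] (S : Set M) (G : Type*) [Group G] : Prop :=
  ∃ f : G → M, Function.Injective f ∧ (∀ a b, f (a * b) = f a * f b) ∧ Set.range f = S

/-- The rotation `R_α` about the x-axis through the angle `α`. -/
def Rmat (α : ℝ) : Matrix (Fin 3) (Fin 3) ℝ :=
  !![1, 0, 0; 0, Real.cos α, -Real.sin α; 0, Real.sin α, Real.cos α]

/-- `A₁₂₃ = span (e₁, e₂, e₃)`, in coordinates. -/
def A123 : Submodule ℝ (Fin 7 → ℝ) :=
  Submodule.span ℝ {![1, 0, 0, 0, 0, 0, 0], ![0, 1, 0, 0, 0, 0, 0], ![0, 0, 1, 0, 0, 0, 0]}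

/-- `A₁₄₅ = span (e₁, e₄, e₅)`, in coordinates. -/
def A145 : Submodule ℝ (Fin 7 → ℝ) :=
  Submodule.span ℝ {![1, 0, 0, 0, 0, 0, 0], ![0, 0, 0, 1, 0, 0, 0], ![0, 0, 0, 0, 1, 0, 0]}

/-- `A₁₆₇ = span (e₁, e₆, e₇)`, in coordinates. -/
def A167 : Submodule ℝ (Fin 7 → ℝ) :=
  Submodule.span ℝ {![1, 0, 0, 0, 0, 0, 0], ![0, 0, 0, 0, 0, 1, 0], ![0, 0, 0, 0, 0, 0, 1]}

/-- The tetrahedral group `Tet ≅ A₄ ⊂ SO(3)`: the group (= multiplicative closure, as all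
generators have finite order) generated by the two listed rotations. -/
def TetSet : Set (Matrix (Fin 3) (Fin 3) ℝ) :=
  (Submonoid.closure {!![-1, 0, 0; 0, -1, 0; 0, 0, 1], !![0, 0, 1; 1, 0, 0; 0, 1, 0]} :
    Submonoid (Matrix (Fin 3) (Fin 3) ℝ))

/-- The family `P_θ` of `Tet`-invariant 3-planes, in coordinates:
`P_θ = span (cos θ·e₁ + sin θ·e₅, cos θ·(√3e₂+√5e₆) − sin θ·(√5e₂−√3e₆),
cos θ·(√3e₃−√5e₇) + sin θ·(√5e₃+√3e₇))`. -/
def Ptet (θ : ℝ) : Submodule ℝ (Fin 7 → ℝ) :=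
  Submodule.span ℝ
    {![Real.cos θ, 0, 0, 0, Real.sin θ, 0, 0],
      ![0, Real.sqrt 3 * Real.cos θ - Real.sqrt 5 * Real.sin θ, 0, 0, 0,
        Real.sqrt 5 * Real.cos θ + Real.sqrt 3 * Real.sin θ, 0],
      ![0, 0, Real.sqrt 3 * Real.cos θ + Real.sqrt 5 * Real.sin θ, 0, 0, 0,
        -(Real.sqrt 5 * Real.cos θ) + Real.sqrt 3 * Real.sin θ]}

lemma eval_sAct (A : Matrix (Fin 3) (Fin 3) ℝ) (p : P3) (w : Fin 3 → ℝ) :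
    eval w (sAct A p) = eval (A⁻¹ *ᵥ w) p := by
  unfold sAct
  induction p using MvPolynomial.induction_on with
  | C a => simp
  | add p q hp hq => simp only [map_add, hp, hq]
  | mul_X p i hp =>
    simp only [map_mul, hp, aeval_X, eval_X, map_sum, smul_eval, Matrix.mulVec, dotProduct]

lemma sAct_one (p : P3) : sAct 1 p = p :=
  MvPolynomial.funext fun w => by simp [eval_sAct]

lemma sAct_mul (A B : Matrix (Fin 3) (Fin 3) ℝ) (p : P3) :
    sAct (A * B) p = sAct A (sAct B p) :=
  MvPolynomial.funext fun w => by
    simp only [eval_sAct, Matrix.mul_inv_rev, Matrix.mulVec_mulVec]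

/-- The substitution action as a linear map. -/
def sActLin (A : Matrix (Fin 3) (Fin 3) ℝ) : P3 →ₗ[ℝ] P3 :=
  (aeval (fun i => ∑ j, A⁻¹ i j • (X j : P3))).toLinearMap

/-- The coordinate identification `iotaH` as a linear map. -/
def iotaLin : (Fin 7 → ℝ) →ₗ[ℝ] P3 := Fintype.linearCombination ℝ eH

lemma iotaLin_apply (v : Fin 7 → ℝ) : iotaLin v = iotaH v := rfl

lemma polySet_eq_map (E : Submodule ℝ (Fin 7 → ℝ)) :
    polySet E = (E.map iotaLin : Submodule ℝ P3) := rfl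

lemma invUnder_one (E : Submodule ℝ (Fin 7 → ℝ)) : InvUnder 1 E := by
  simp [InvUnder, sAct_one]

lemma InvUnder.mul {A B : Matrix (Fin 3) (Fin 3) ℝ} {E : Submodule ℝ (Fin 7 → ℝ)}
    (hA : InvUnder A E) (hB : InvUnder B E) : InvUnder (A * B) E := by
  unfold InvUnder at *
  rw [show sAct (A * B) = sAct A ∘ sAct B from _root_.funext (sAct_mul A B), Set.image_comp, hB, hA]

lemma invUnder_of_mapsTo {A B : Matrix (Fin 3) (Fin 3) ℝ} {E : Submodule ℝ (Fin 7 → ℝ)}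
    (hAB : A * B = 1) (hA : ∀ p ∈ polySet E, sAct A p ∈ polySet E)
    (hB : ∀ p ∈ polySet E, sAct B p ∈ polySet E) : InvUnder A E := by
  apply Set.Subset.antisymm
  · rintro _ ⟨p, hp, rfl⟩
    exact hA p hp
  · intro p hp
    exact ⟨sAct B p, hB p hp, by rw [← sAct_mul, hAB, sAct_one]⟩

/-- The cubic `a p (2p² - 3q² - 3r²) + b p (q² - r²)`. -/
def cub (a b : ℝ) (p q r : P3) : P3 :=
  C a * (p * (2 * p ^ 2 - 3 * q ^ 2 - 3 * r ^ 2)) + C b * (p * (q ^ 2 - r ^ 2))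

/-- The span of the three cyclic permutations of `cub a b x y z`. -/
def cubSpan (a b : ℝ) : Submodule ℝ P3 :=
  Submodule.span ℝ {cub a b (X 0) (X 1) (X 2), cub a b (X 1) (X 2) (X 0),
    cub a b (X 2) (X 0) (X 1)}

lemma sqrt_six : √6 = √2 * √3 := by
  rw [← Real.sqrt_mul (by norm_num)]; norm_num

lemma sqrt_ten : √10 = √2 * √5 := by
  rw [← Real.sqrt_mul (by norm_num)]; norm_num

lemma sqrt_fifteen : √15 = √3 * √5 := by
  rw [← Real.sqrt_mul (by norm_num)]; norm_num

lemma eval_iotaH (v : Fin 7 → ℝ) (w : Fin 3 → ℝ) :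
    eval w (iotaH v) = v 0 * (1 / 5 * (w 0 * (2 * w 0 ^ 2 - 3 * w 1 ^ 2 - 3 * w 2 ^ 2))) +
      v 1 * (√2 * √3 / 10 * (w 2 * (4 * w 0 ^ 2 - w 1 ^ 2 - w 2 ^ 2))) +
      v 2 * (√2 * √3 / 10 * (w 1 * (4 * w 0 ^ 2 - w 1 ^ 2 - w 2 ^ 2))) +
      v 3 * (2 * (√3 * √5) / 5 * (w 0 * w 1 * w 2)) +
      v 4 * (√3 * √5 / 5 * (w 0 * (w 1 ^ 2 - w 2 ^ 2))) +
      v 5 * (√2 * √5 / 10 * (w 2 * (3 * w 1 ^ 2 - w 2 ^ 2))) +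
      v 6 * (√2 * √5 / 10 * (w 1 * (w 1 ^ 2 - 3 * w 2 ^ 2))) := by
  simp [iotaH, eH, Fin.sum_univ_succ, smul_eval, sqrt_six, sqrt_ten, sqrt_fifteen]
  ring

lemma span_triple_smul {V : Type*} [AddCommGroup V] [Module ℝ V] (u v w : V) {k : ℝ}
    (hk : k ≠ 0) :
    Submodule.span ℝ {u, k • v, k • w} = Submodule.span ℝ {u, v, w} := by
  have h (x : V) : Submodule.span ℝ {k • x} = Submodule.span ℝ {x} :=
    Submodule.span_singleton_smul_eq hk.isUnit x
  rw [Submodule.span_insert, Submodule.span_insert (k • v), Submodule.span_insert u,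
    Submodule.span_insert v, h, h]

lemma polySet_Ptet (θ : ℝ) :
    polySet (Ptet θ) = (cubSpan (Real.cos θ / 5) (√15 / 5 * Real.sin θ) : Set P3) := by
  have hk : -(2 * √2) ≠ 0 := by simp
  have h2 : √2 ^ 2 = 2 := Real.sq_sqrt (by norm_num)
  have h3 : √3 ^ 2 = 3 := Real.sq_sqrt (by norm_num)
  have h5 : √5 ^ 2 = 5 := Real.sq_sqrt (by norm_num)
  rw [polySet_eq_map, Ptet, Submodule.map_span, cubSpan, ← span_triple_smul _ _ _ hk]
  simp only [Set.image_insert_eq, Set.image_singleton, iotaLin_apply]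
  rw [Set.pair_comm]
  congr 4
  · refine MvPolynomial.funext fun w => ?_
    rw [eval_iotaH]
    simp [cub, sqrt_fifteen]
    ring
  · refine MvPolynomial.funext fun w => ?_
    rw [eval_iotaH]
    simp [cub, sqrt_fifteen, smul_eval]
    grind
  · rw [Set.singleton_eq_singleton_iff]
    refine MvPolynomial.funext fun w => ?_
    rw [eval_iotaH]
    simp [cub, sqrt_fifteen, smul_eval]
    grind

lemma mapsTo_of_cubSpan {A : Matrix (Fin 3) (Fin 3) ℝ} {a b : ℝ}
    (h0 : sAct A (cub a b (X 0) (X 1) (X 2)) ∈ cubSpan a b)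
    (h1 : sAct A (cub a b (X 1) (X 2) (X 0)) ∈ cubSpan a b)
    (h2 : sAct A (cub a b (X 2) (X 0) (X 1)) ∈ cubSpan a b) :
    ∀ p ∈ (cubSpan a b : Set P3), sAct A p ∈ (cubSpan a b : Set P3) := by
  intro p hp
  have : cubSpan a b ≤ (cubSpan a b).comap (sActLin A) := by
    conv_lhs => rw [cubSpan]
    rw [Submodule.span_le]
    rintro q (rfl | rfl | rfl)
    exacts [h0, h1, h2]
  exact this hp

lemma mem_cubSpan {a b : ℝ} {p : P3} (x y z : ℝ)
    (h : ∀ w, eval w p = x * eval w (cub a b (X 0) (X 1) (X 2)) +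
      y * eval w (cub a b (X 1) (X 2) (X 0)) + z * eval w (cub a b (X 2) (X 0) (X 1))) :
    p ∈ cubSpan a b := by
  rw [cubSpan, Submodule.mem_span_triple]
  exact ⟨x, y, z, MvPolynomial.funext fun w => by simp [h, smul_eval]⟩

/-- The half-turn about the z-axis. -/
abbrev halfTurn : Matrix (Fin 3) (Fin 3) ℝ := !![-1, 0, 0; 0, -1, 0; 0, 0, 1]

/-- The cyclic permutation matrix. -/
abbrev cyc : Matrix (Fin 3) (Fin 3) ℝ := !![0, 0, 1; 1, 0, 0; 0, 1, 0]

/-- The half-turn exchanging the x-axis and the y-axis. -/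
abbrev swapXY : Matrix (Fin 3) (Fin 3) ℝ := !![0, 1, 0; 1, 0, 0; 0, 0, -1]

/-- A half-turn of the icosahedron, where `h` is a root of `h² = h + 1`. -/
abbrev icos (h : ℝ) : Matrix (Fin 3) (Fin 3) ℝ :=
  !![-1 / 2, h / 2, (h - 1) / 2; h / 2, (h - 1) / 2, 1 / 2; (h - 1) / 2, 1 / 2, -h / 2]

lemma halfTurn_mul_self : halfTurn * halfTurn = 1 := by
  ext i j; fin_cases i <;> fin_cases j <;> simp [Matrix.mul_apply, Fin.sum_univ_three]

lemma cyc_mul_cyc_mul_cyc : cyc * (cyc * cyc) = 1 := by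
  ext i j; fin_cases i <;> fin_cases j <;> simp [Matrix.mul_apply, Fin.sum_univ_three]

lemma swapXY_mul_self : swapXY * swapXY = 1 := by
  ext i j; fin_cases i <;> fin_cases j <;> simp [Matrix.mul_apply, Fin.sum_univ_three]

lemma icos_mul_self {h : ℝ} (hh : h ^ 2 = h + 1) : icos h * icos h = 1 := by
  ext i j
  fin_cases i <;> fin_cases j <;> simp [Matrix.mul_apply, Fin.sum_univ_three] <;> grind

lemma invUnder_of_involution {A : Matrix (Fin 3) (Fin 3) ℝ} (hA : A * A = 1) {θ a b : ℝ}
    (hab : polySet (Ptet θ) = cubSpan a b)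
    (h0 : sAct A (cub a b (X 0) (X 1) (X 2)) ∈ cubSpan a b)
    (h1 : sAct A (cub a b (X 1) (X 2) (X 0)) ∈ cubSpan a b)
    (h2 : sAct A (cub a b (X 2) (X 0) (X 1)) ∈ cubSpan a b) : InvUnder A (Ptet θ) := by
  have := mapsTo_of_cubSpan h0 h1 h2
  rw [← hab] at this
  exact invUnder_of_mapsTo hA this this

lemma invUnder_halfTurn (θ : ℝ) : InvUnder halfTurn (Ptet θ) := by
  have hi := Matrix.inv_eq_right_inv halfTurn_mul_self
  refine invUnder_of_involution halfTurn_mul_self (polySet_Ptet θ) ?_ ?_ ?_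
  · refine mem_cubSpan (-1) 0 0 fun w => ?_
    simp [eval_sAct, hi, cub, dotProduct, Fin.sum_univ_three]
    ring
  · refine mem_cubSpan 0 (-1) 0 fun w => ?_
    simp [eval_sAct, hi, cub, dotProduct, Fin.sum_univ_three]
    ring
  · refine mem_cubSpan 0 0 1 fun w => ?_
    simp [eval_sAct, hi, cub, dotProduct, Fin.sum_univ_three]

lemma cyc_inv : cyc⁻¹ = !![0, 1, 0; 0, 0, 1; 1, 0, 0] := by
  apply Matrix.inv_eq_right_inv
  ext i j; fin_cases i <;> fin_cases j <;> simp [Matrix.mul_apply, Fin.sum_univ_three]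

lemma invUnder_cyc (θ : ℝ) : InvUnder cyc (Ptet θ) := by
  have key : ∀ p ∈ polySet (Ptet θ), sAct cyc p ∈ polySet (Ptet θ) := by
    rw [polySet_Ptet]
    refine mapsTo_of_cubSpan ?_ ?_ ?_
    · refine mem_cubSpan 0 1 0 fun w => ?_
      simp [eval_sAct, cyc_inv, cub, dotProduct, Fin.sum_univ_three]
    · refine mem_cubSpan 0 0 1 fun w => ?_
      simp [eval_sAct, cyc_inv, cub, dotProduct, Fin.sum_univ_three]
    · refine mem_cubSpan 1 0 0 fun w => ?_
      simp [eval_sAct, cyc_inv, cub, dotProduct, Fin.sum_univ_three]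
  refine invUnder_of_mapsTo cyc_mul_cyc_mul_cyc key fun p hp => ?_
  rw [sAct_mul]
  exact key _ (key _ hp)

lemma invUnder_of_mem_TetSet (θ : ℝ) {A : Matrix (Fin 3) (Fin 3) ℝ} (hA : A ∈ TetSet) :
    InvUnder A (Ptet θ) := by
  induction hA using Submonoid.closure_induction with
  | mem A hA =>
    rcases hA with rfl | rfl
    exacts [invUnder_halfTurn θ, invUnder_cyc θ]
  | one => exact invUnder_one _
  | mul A B _ _ hA hB => exact hA.mul hB

lemma finrank_span_triple {u v w : Fin 7 → ℝ} (hli : LinearIndependent ℝ ![u, v, w]) :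
    Module.finrank ℝ (Submodule.span ℝ {u, v, w}) = 3 := by
  have := finrank_span_eq_card hli
  rwa [Fintype.card_fin, Matrix.range_cons, Matrix.range_cons, Matrix.range_cons,
    Matrix.range_empty, Set.union_empty, ← Set.insert_eq, ← Set.insert_eq] at this

lemma finrank_Ptet (θ : ℝ) : Module.finrank ℝ (Ptet θ) = 3 := by
  have h3 : √3 ^ 2 = 3 := Real.sq_sqrt (by norm_num)
  have h5 : √5 ^ 2 = 5 := Real.sq_sqrt (by norm_num)
  have hcs := Real.sin_sq_add_cos_sq θ
  set c := Real.cos θ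
  set s := Real.sin θ
  have hli : LinearIndependent ℝ
      ![(![c, 0, 0, 0, s, 0, 0] : Fin 7 → ℝ),
        ![0, √3 * c - √5 * s, 0, 0, 0, √5 * c + √3 * s, 0],
        ![0, 0, √3 * c + √5 * s, 0, 0, 0, -(√5 * c) + √3 * s]] := by
    rw [Fintype.linearIndependent_iff]
    intro g hg
    have e (i : Fin 7) := congrFun hg i
    simp only [Fin.sum_univ_three] at e
    have e0 := e 0
    have e1 := e 1
    have e2 := e 2
    have e4 := e 4
    have e5 := e 5
    have e6 := e 6
    simp [-mul_eq_zero] at e0 e1 e2 e4 e5 e6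
    intro i
    fin_cases i
    · show g 0 = 0
      linear_combination c * e0 + s * e4 - g 0 * hcs
    · show g 1 = 0
      linear_combination (√3 * c - √5 * s) / 8 * e1 + (√5 * c + √3 * s) / 8 * e5 -
        g 1 * hcs - g 1 * (c ^ 2 + s ^ 2) / 8 * (h3 + h5)
    · show g 2 = 0
      linear_combination (√3 * c + √5 * s) / 8 * e2 + (-(√5 * c) + √3 * s) / 8 * e6 -
        g 2 * hcs - g 2 * (c ^ 2 + s ^ 2) / 8 * (h3 + h5)
  exact finrank_span_triple hli

lemma iotaH_injective : Function.Injective iotaH := by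
  have key : Function.Injective iotaLin := by
    rw [injective_iff_map_eq_zero]
    intro v hv
    rw [iotaLin_apply] at hv
    have e (w : Fin 3 → ℝ) := eval_iotaH v w
    simp only [hv, map_zero] at e
    have p1 := e ![1, 0, 0]
    have p2 := e ![0, 1, 0]
    have p3 := e ![0, 0, 1]
    have p4 := e ![1, 1, 0]
    have p5 := e ![1, -1, 0]
    have p6 := e ![1, 0, 1]
    have p7 := e ![1, 0, -1]
    have p8 := e ![1, 1, 1]
    have h2 : √2 ≠ 0 := by simp
    have h3 : √3 ≠ 0 := by simp
    have h5 : √5 ≠ 0 := by simp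
    simp at p1 p2 p3 p4 p5 p6 p7 p8
    have a0 : v 0 = 0 := p1
    have a1 : v 1 * (√2 * √3) = 0 := by linarith
    have a2 : v 2 * (√2 * √3) = 0 := by linarith
    have a5 : v 5 * (√2 * √5) = 0 := by linarith
    have a6 : v 6 * (√2 * √5) = 0 := by linarith
    have a4 : v 4 * (√3 * √5) = 0 := by linarith
    have a3 : v 3 * (√3 * √5) = 0 := by linarith
    simp [h2, h3, h5] at a1 a2 a3 a4 a5 a6
    ext i
    fin_cases i <;> assumption
  exact key

/-- The action of the cyclic permutation in coordinates. -/
def cycCoord (v : Fin 7 → ℝ) : Fin 7 → ℝ :=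
  ![-(√2 * √3) / 4 * v 1 - √2 * √5 / 4 * v 5, -1 / 4 * v 2 - √3 * √5 / 4 * v 6,
    -(√2 * √3) / 4 * v 0 - √2 * √5 / 4 * v 4, v 3, √2 * √5 / 4 * v 1 - √2 * √3 / 4 * v 5,
    √3 * √5 / 4 * v 2 - 1 / 4 * v 6, √2 * √5 / 4 * v 0 - √2 * √3 / 4 * v 4]

lemma sAct_cyc_iotaH (v : Fin 7 → ℝ) : sAct cyc (iotaH v) = iotaH (cycCoord v) := by
  have h2 : √2 ^ 2 = 2 := Real.sq_sqrt (by norm_num)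
  have h3 : √3 ^ 2 = 3 := Real.sq_sqrt (by norm_num)
  have h5 : √5 ^ 2 = 5 := Real.sq_sqrt (by norm_num)
  refine MvPolynomial.funext fun w => ?_
  rw [eval_sAct, eval_iotaH, eval_iotaH]
  simp [cyc_inv, cycCoord, Matrix.mulVec, dotProduct, Fin.sum_univ_three]
  grind

lemma sAct_halfTurn_iotaH (v : Fin 7 → ℝ) : sAct halfTurn (iotaH v) =
    iotaH ![-v 0, v 1, -v 2, v 3, -v 4, v 5, -v 6] := by
  have hi := Matrix.inv_eq_right_inv halfTurn_mul_self
  refine MvPolynomial.funext fun w => ?_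
  rw [eval_sAct, eval_iotaH, eval_iotaH]
  simp [hi, Matrix.mulVec, dotProduct, Fin.sum_univ_three]

/-- The half-turn about the x-axis. -/
abbrev halfTurnX : Matrix (Fin 3) (Fin 3) ℝ := !![1, 0, 0; 0, -1, 0; 0, 0, -1]

lemma halfTurnX_eq : halfTurnX = cyc * (halfTurn * (cyc * cyc)) := by
  ext i j; fin_cases i <;> fin_cases j <;> simp [Matrix.mul_apply, Fin.sum_univ_three]

lemma sAct_halfTurnX_iotaH (v : Fin 7 → ℝ) : sAct halfTurnX (iotaH v) =
    iotaH ![v 0, -v 1, -v 2, v 3, v 4, -v 5, -v 6] := by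
  have hi : halfTurnX⁻¹ = halfTurnX := by
    apply Matrix.inv_eq_right_inv
    ext i j; fin_cases i <;> fin_cases j <;> simp [Matrix.mul_apply, Fin.sum_univ_three]
  refine MvPolynomial.funext fun w => ?_
  rw [eval_sAct, eval_iotaH, eval_iotaH]
  simp [hi, Matrix.mulVec, dotProduct, Fin.sum_univ_three]

lemma halfTurn_mem : halfTurn ∈ TetSet := Submonoid.subset_closure (by simp)

lemma cyc_mem : cyc ∈ TetSet := Submonoid.subset_closure (by simp)

lemma halfTurnX_mem : halfTurnX ∈ TetSet := by
  rw [halfTurnX_eq]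
  have hc := cyc_mem
  exact Submonoid.mul_mem _ hc (Submonoid.mul_mem _ halfTurn_mem (Submonoid.mul_mem _ hc hc))

lemma InvUnder.mem_of_sAct_eq {A : Matrix (Fin 3) (Fin 3) ℝ} {E : Submodule ℝ (Fin 7 → ℝ)}
    (hA : InvUnder A E) {v w : Fin 7 → ℝ} (hv : v ∈ E) (h : sAct A (iotaH v) = iotaH w) :
    w ∈ E := by
  have : sAct A (iotaH v) ∈ polySet E := hA ▸ Set.mem_image_of_mem _ (Set.mem_image_of_mem _ hv)
  obtain ⟨w', hw', e⟩ := this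
  rwa [← iotaH_injective (e.trans h)]

lemma eq_Ptet_of_invUnder {E : Submodule ℝ (Fin 7 → ℝ)} (hE : Module.finrank ℝ E = 3)
    (hinv : ∀ A ∈ TetSet, InvUnder A E) : ∃ θ : ℝ, E = Ptet θ := by
  have h2 : √2 ^ 2 = 2 := Real.sq_sqrt (by norm_num)
  have h3 : √3 ^ 2 = 3 := Real.sq_sqrt (by norm_num)
  have h5 : √5 ^ 2 = 5 := Real.sq_sqrt (by norm_num)
  have hcyc {v} (hv : v ∈ E) : cycCoord v ∈ E :=
    (hinv _ cyc_mem).mem_of_sAct_eq hv (sAct_cyc_iotaH v)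
  have hproj {v} (hv : v ∈ E) : ![v 0, 0, 0, 0, v 4, 0, 0] ∈ E := by
    have ha := (hinv _ halfTurn_mem).mem_of_sAct_eq hv (sAct_halfTurn_iotaH v)
    have h := E.sub_mem hv ha
    have hb := (hinv _ halfTurnX_mem).mem_of_sAct_eq h (sAct_halfTurnX_iotaH _)
    convert E.smul_mem (1 / 4) (E.add_mem h hb) using 1
    ext i
    simp only [Pi.smul_apply, Pi.add_apply, Pi.sub_apply]
    fin_cases i <;> simp
    all_goals ring
  obtain ⟨p, q, hpq, hmem⟩ : ∃ p q : ℝ, p ^ 2 + q ^ 2 ≠ 0 ∧ ![p, 0, 0, 0, q, 0, 0] ∈ E := by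
    by_contra! hcon
    have hz {v} (hv : v ∈ E) : v 0 = 0 ∧ v 4 = 0 := by
      have : v 0 ^ 2 + v 4 ^ 2 = 0 := by
        by_contra hne
        exact hcon _ _ hne (hproj hv)
      constructor <;> nlinarith
    have hle : E ≤ Submodule.span ℝ {![0, 0, 0, 1, 0, 0, 0]} := by
      intro v hv
      rw [Submodule.mem_span_singleton]
      refine ⟨v 3, ?_⟩
      have hcyc' {v} (hv : v ∈ E) : v 1 = 0 ∧ v 5 = 0 := by
        obtain ⟨k1, k2⟩ := hz (hcyc hv)
        simp [cycCoord] at k1 k2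
        constructor
        · linear_combination (-√2 * √3 / 4) * k1 + (√2 * √5 / 4) * k2 -
            v 1 * (h3 + h5) / 8 - v 1 * (√3 ^ 2 + √5 ^ 2) / 16 * h2
        · linear_combination (-√2 * √5 / 4) * k1 - (√2 * √3 / 4) * k2 -
            v 5 * (h3 + h5) / 8 - v 5 * (√3 ^ 2 + √5 ^ 2) / 16 * h2
      obtain ⟨k1, k2⟩ := hcyc' (hcyc hv)
      obtain ⟨k3, k4⟩ := hcyc' hv
      obtain ⟨k5, k6⟩ := hz hv
      simp [cycCoord] at k1 k2
      have k7 : v 2 = 0 := by grind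
      have k8 : v 6 = 0 := by grind
      ext i
      fin_cases i <;> simp [k3, k4, k5, k6, k7, k8]
    have := Submodule.finrank_mono hle
    have := finrank_span_le_card (R := ℝ) ({![0, 0, 0, 1, 0, 0, 0]} : Set (Fin 7 → ℝ))
    rw [Set.toFinset_singleton, Finset.card_singleton] at this
    omega
  obtain ⟨r, θ, hr, hp, hq⟩ : ∃ r θ : ℝ, r ≠ 0 ∧ p = r * Real.cos θ ∧ q = r * Real.sin θ := by
    refine ⟨‖(⟨p, q⟩ : ℂ)‖, Complex.arg ⟨p, q⟩, ?_, ?_, ?_⟩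
    · rw [norm_ne_zero_iff]
      intro h
      have h1 : p = 0 := congrArg Complex.re h
      have h2 : q = 0 := congrArg Complex.im h
      simp [h1, h2] at hpq
    · rw [Complex.norm_mul_cos_arg]
    · rw [Complex.norm_mul_sin_arg]
  refine ⟨θ, (Submodule.eq_of_le_of_finrank_eq ?_ (by rw [hE, finrank_Ptet])).symm⟩
  rw [Ptet, Submodule.span_le]
  have hu : ![Real.cos θ, 0, 0, 0, Real.sin θ, 0, 0] ∈ E := by
    convert E.smul_mem r⁻¹ hmem using 1
    ext i
    fin_cases i <;> simp [hp, hq, hr]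
  rintro v (rfl | rfl | rfl)
  · exact hu
  · rw [SetLike.mem_coe]
    convert E.smul_mem (-(2 * √2)) (hcyc (hcyc hu)) using 1
    ext i
    fin_cases i <;> simp [cycCoord] <;> grind
  · rw [SetLike.mem_coe]
    convert E.smul_mem (-(2 * √2)) (hcyc hu) using 1
    ext i
    fin_cases i <;> simp [cycCoord] <;> grind

lemma finrank_span_of_orthonormal {u v w : Fin 7 → ℝ} (huu : dot7 u u = 1)
    (hvv : dot7 v v = 1) (hww : dot7 w w = 1) (huv : dot7 u v = 0) (huw : dot7 u w = 0)
    (hvw : dot7 v w = 0) : Module.finrank ℝ (Submodule.span ℝ {u, v, w}) = 3 := by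
  refine finrank_span_triple ?_
  rw [Fintype.linearIndependent_iff]
  intro g hg
  simp [Fin.sum_univ_three] at hg
  have e (i : Fin 7) := congrFun hg i
  simp only [Pi.add_apply, Pi.smul_apply, smul_eq_mul, Pi.zero_apply] at e
  have hd (t : Fin 7 → ℝ) : g 0 * dot7 u t + g 1 * dot7 v t + g 2 * dot7 w t = 0 := by
    simp only [dot7, Finset.mul_sum, ← Finset.sum_add_distrib]
    refine Finset.sum_eq_zero fun i _ => ?_
    linear_combination t i * e i
  have hc (s t : Fin 7 → ℝ) : dot7 s t = dot7 t s := by simp [dot7, mul_comm]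
  intro i
  fin_cases i
  · simpa [huu, hc v u, hc w u, huv, huw] using hd u
  · simpa [hvv, hc w v, huv, hvw] using hd v
  · simpa [hww, huw, hvw] using hd w

lemma finrank_of_isAssocSubspace {E : Submodule ℝ (Fin 7 → ℝ)} (h : IsAssocSubspace E) :
    Module.finrank ℝ E = 3 := by
  obtain ⟨u, v, w, -, -, -, huu, hvv, hww, huv, huw, hvw, rfl, -⟩ := h
  exact finrank_span_of_orthonormal huu hvv hww huv huw hvw

/-- The linear combination with coefficients `x` of the three vectors spanning `Ptet θ`. -/
def tetVec (θ : ℝ) (x : Fin 3 → ℝ) : Fin 7 → ℝ :=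
  ![x 0 * Real.cos θ, x 1 * (√3 * Real.cos θ - √5 * Real.sin θ),
    x 2 * (√3 * Real.cos θ + √5 * Real.sin θ), 0, x 0 * Real.sin θ,
    x 1 * (√5 * Real.cos θ + √3 * Real.sin θ), x 2 * (-(√5 * Real.cos θ) + √3 * Real.sin θ)]

lemma mem_Ptet_iff {θ : ℝ} {v : Fin 7 → ℝ} : v ∈ Ptet θ ↔ ∃ x, tetVec θ x = v := by
  rw [Ptet, Submodule.mem_span_triple]
  constructor
  · rintro ⟨a, b, c, rfl⟩
    refine ⟨![a, b, c], ?_⟩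
    ext i
    fin_cases i <;> simp [tetVec]
  · rintro ⟨x, rfl⟩
    refine ⟨x 0, x 1, x 2, ?_⟩
    ext i
    fin_cases i <;> simp [tetVec]

lemma dot7_tetVec (θ : ℝ) (x y : Fin 3 → ℝ) :
    dot7 (tetVec θ x) (tetVec θ y) = x 0 * y 0 + 8 * (x 1 * y 1) + 8 * (x 2 * y 2) := by
  have h3 : √3 ^ 2 = 3 := Real.sq_sqrt (by norm_num)
  have h5 : √5 ^ 2 = 5 := Real.sq_sqrt (by norm_num)
  have hcs := Real.sin_sq_add_cos_sq θ
  simp [dot7, tetVec, Fin.sum_univ_succ]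
  linear_combination (x 0 * y 0 + 8 * (x 1 * y 1) + 8 * (x 2 * y 2)) * hcs +
    (x 1 * y 1 + x 2 * y 2) * (Real.sin θ ^ 2 + Real.cos θ ^ 2) * (h3 + h5)

lemma phi0_tetVec (θ : ℝ) (x y z : Fin 3 → ℝ) :
    phi0 (tetVec θ x) (tetVec θ y) (tetVec θ z) =
      Matrix.det (Matrix.of ![x, y, z]) * (8 * Real.cos (3 * θ)) := by
  have h3 : √3 ^ 2 = 3 := Real.sq_sqrt (by norm_num)
  have h5 : √5 ^ 2 = 5 := Real.sq_sqrt (by norm_num)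
  have hcs := Real.sin_sq_add_cos_sq θ
  have hexp (c s P Q R T : ℝ) :
      phi0 ![x 0 * c, x 1 * P, x 2 * Q, 0, x 0 * s, x 1 * R, x 2 * T]
        ![y 0 * c, y 1 * P, y 2 * Q, 0, y 0 * s, y 1 * R, y 2 * T]
        ![z 0 * c, z 1 * P, z 2 * Q, 0, z 0 * s, z 1 * R, z 2 * T] =
      Matrix.det (Matrix.of ![x, y, z]) * (c * P * Q - c * R * T - s * R * Q - s * P * T) := by
    simp [phi0, triD, Matrix.det_fin_three]
    ring
  unfold tetVec
  rw [hexp, Real.cos_three_mul]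
  congr 1
  set c := Real.cos θ
  set s := Real.sin θ
  linear_combination (c ^ 3 - 3 * c * s ^ 2) * (h3 + h5) - 24 * c * hcs

lemma sq_det_eq_one {N : Matrix (Fin 3) (Fin 3) ℝ} (h : N * Nᵀ = 1) : N.det ^ 2 = 1 := by
  have := congrArg Matrix.det h
  rwa [Matrix.det_mul, Matrix.det_transpose, Matrix.det_one, ← sq] at this

lemma isAssocSubspace_Ptet_iff_sin (θ : ℝ) :
    IsAssocSubspace (Ptet θ) ↔ Real.sin (3 * θ) = 0 := by
  have h2 : √2 ^ 2 = 2 := Real.sq_sqrt (by norm_num)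
  have hcs3 := Real.sin_sq_add_cos_sq (3 * θ)
  constructor
  · rintro ⟨u, v, w, hu, hv, hw, huu, hvv, hww, huv, huw, hvw, -, hphi⟩
    obtain ⟨x, rfl⟩ := mem_Ptet_iff.1 hu
    obtain ⟨y, rfl⟩ := mem_Ptet_iff.1 hv
    obtain ⟨z, rfl⟩ := mem_Ptet_iff.1 hw
    rw [dot7_tetVec] at huu hvv hww huv huw hvw
    rw [phi0_tetVec] at hphi
    set N : Matrix (Fin 3) (Fin 3) ℝ :=
      !![x 0, 2 * √2 * x 1, 2 * √2 * x 2; y 0, 2 * √2 * y 1, 2 * √2 * y 2;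
        z 0, 2 * √2 * z 1, 2 * √2 * z 2] with hN
    have hNN : N * Nᵀ = 1 := by
      ext i j
      fin_cases i <;> fin_cases j <;>
        simp [hN, Matrix.mul_apply, Fin.sum_univ_three] <;> grind
    have hdet : N.det = Matrix.det (Matrix.of ![x, y, z]) * 8 := by
      simp [hN, Matrix.det_fin_three]
      grind
    have hsq := sq_det_eq_one hNN
    have hcos : Real.cos (3 * θ) ^ 2 = 1 := by
      have : (N.det * Real.cos (3 * θ)) ^ 2 = 1 := by
        rw [sq_eq_one_iff, hdet, mul_assoc]
        exact hphi
      rwa [mul_pow, hsq, one_mul] at this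
    nlinarith
  · intro hsin
    have hcos : Real.cos (3 * θ) ^ 2 = 1 := by nlinarith
    set r := 1 / (2 * √2) with hr
    have hr2 : r ^ 2 = 1 / 8 := by
      rw [hr, div_pow, mul_pow, h2]; norm_num
    have huu : dot7 (tetVec θ ![1, 0, 0]) (tetVec θ ![1, 0, 0]) = 1 := by simp [dot7_tetVec]
    have hvv : dot7 (tetVec θ ![0, r, 0]) (tetVec θ ![0, r, 0]) = 1 := by
      simp [dot7_tetVec]; linarith
    have hww : dot7 (tetVec θ ![0, 0, r]) (tetVec θ ![0, 0, r]) = 1 := by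
      simp [dot7_tetVec]; linarith
    have huv : dot7 (tetVec θ ![1, 0, 0]) (tetVec θ ![0, r, 0]) = 0 := by simp [dot7_tetVec]
    have huw : dot7 (tetVec θ ![1, 0, 0]) (tetVec θ ![0, 0, r]) = 0 := by simp [dot7_tetVec]
    have hvw : dot7 (tetVec θ ![0, r, 0]) (tetVec θ ![0, 0, r]) = 0 := by simp [dot7_tetVec]
    have hmem (x : Fin 3 → ℝ) : tetVec θ x ∈ Ptet θ := mem_Ptet_iff.2 ⟨x, rfl⟩
    refine ⟨_, _, _, hmem _, hmem _, hmem _, huu, hvv, hww, huv, huw, hvw, ?_, ?_⟩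
    · refine Submodule.eq_of_le_of_finrank_eq ?_
        (by rw [finrank_span_of_orthonormal huu hvv hww huv huw hvw, finrank_Ptet])
      rw [Submodule.span_le]
      rintro _ (rfl | rfl | rfl) <;> exact hmem _
    · rw [← sq_eq_one_iff, phi0_tetVec]
      have hdet : Matrix.det (Matrix.of ![![1, 0, 0], ![0, r, 0], ![0, 0, r]]) = r ^ 2 := by
        simp [Matrix.det_fin_three, sq]
      rw [hdet]
      linear_combination 64 * (r ^ 2 + 1 / 8) * Real.cos (3 * θ) ^ 2 * hr2 + hcos

lemma sin_three_mul_eq_zero_iff (θ : ℝ) :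
    Real.sin (3 * θ) = 0 ↔ ∃ k : ℤ, θ = k * (Real.pi / 3) := by
  rw [Real.sin_eq_zero_iff]
  refine exists_congr fun k => ?_
  constructor <;> intro h <;> linarith

lemma isAssocSubspace_Ptet_iff (θ : ℝ) :
    IsAssocSubspace (Ptet θ) ↔ ∃ k : ℤ, θ = k * (Real.pi / 3) :=
  (isAssocSubspace_Ptet_iff_sin θ).trans (sin_three_mul_eq_zero_iff θ)

/-- A sextic form on `ℝ³` which is invariant under the tetrahedral group, but not under
`swapXY` or `icos`. -/
def sextic (w : Fin 3 → ℝ) : ℝ := w 0 ^ 4 * w 1 ^ 2 + w 1 ^ 4 * w 2 ^ 2 + w 2 ^ 4 * w 0 ^ 2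

lemma sextic_mulVec {A : Matrix (Fin 3) (Fin 3) ℝ} (hA : A ∈ TetSet) (w : Fin 3 → ℝ) :
    sextic (A *ᵥ w) = sextic w := by
  induction hA using Submonoid.closure_induction generalizing w with
  | mem A hA =>
    rcases hA with rfl | rfl
    · simp [sextic, Matrix.mulVec, dotProduct, Fin.sum_univ_three]
      ring
    · simp [sextic, Matrix.mulVec, dotProduct, Fin.sum_univ_three]
      ring
  | one => simp
  | mul A B _ _ hA hB => rw [← Matrix.mulVec_mulVec, hA, hB]

lemma swapXY_notMem : swapXY ∉ TetSet := by
  intro h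
  have := sextic_mulVec h ![1, 2, 0]
  have hw : swapXY *ᵥ ![1, 2, 0] = ![2, 1, 0] := by
    ext i; fin_cases i <;> simp
  rw [hw] at this
  simp [sextic] at this

lemma icos_notMem {h : ℝ} (hh : h ^ 2 = h + 1) : icos h ∉ TetSet := by
  intro hA
  have := sextic_mulVec hA ![1, 0, 0]
  simp [sextic] at this
  have h0 : h ≠ 0 := by rintro rfl; norm_num at hh
  have : 0 < h ^ 2 := by positivity
  nlinarith [sq_nonneg (h * (h - 1)), sq_nonneg (h - 1), sq_nonneg (h * h * (h - 1)),
    sq_nonneg ((h - 1) ^ 2)]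

lemma one_mem_SO3 : (1 : Matrix (Fin 3) (Fin 3) ℝ) ∈ SO3 := by simp [SO3]

lemma mul_mem_SO3 {A B : Matrix (Fin 3) (Fin 3) ℝ} (hA : A ∈ SO3) (hB : B ∈ SO3) :
    A * B ∈ SO3 := by
  refine ⟨?_, by rw [Matrix.det_mul, hA.2, hB.2, one_mul]⟩
  rw [Matrix.transpose_mul, Matrix.mul_assoc, ← Matrix.mul_assoc B, hB.1, Matrix.one_mul, hA.1]

lemma TetSet_subset_SO3 : TetSet ⊆ SO3 := by
  intro A hA
  induction hA using Submonoid.closure_induction with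
  | mem A hA =>
    rcases hA with rfl | rfl <;> refine ⟨?_, by simp [Matrix.det_fin_three]⟩ <;>
    · ext i j
      fin_cases i <;> fin_cases j <;> simp [Matrix.mul_apply, Fin.sum_univ_three]
  | one => exact one_mem_SO3
  | mul A B _ _ hA hB => exact mul_mem_SO3 hA hB

lemma swapXY_mem_SO3 : swapXY ∈ SO3 := by
  refine ⟨?_, by simp [Matrix.det_fin_three]⟩
  convert swapXY_mul_self using 2
  ext i j; fin_cases i <;> fin_cases j <;> rfl

lemma icos_mem_SO3 {h : ℝ} (hh : h ^ 2 = h + 1) : icos h ∈ SO3 := by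
  refine ⟨?_, ?_⟩
  · convert icos_mul_self hh using 2
    ext i j; fin_cases i <;> fin_cases j <;> rfl
  · simp [Matrix.det_fin_three]
    grind

lemma invUnder_swapXY {θ : ℝ} (hs : Real.sin θ = 0) : InvUnder swapXY (Ptet θ) := by
  have hi := Matrix.inv_eq_right_inv swapXY_mul_self
  have hP := polySet_Ptet θ
  rw [hs, mul_zero] at hP
  refine invUnder_of_involution swapXY_mul_self hP ?_ ?_ ?_
  · refine mem_cubSpan 0 1 0 fun w => ?_
    simp [eval_sAct, hi, cub, dotProduct, Fin.sum_univ_three, -mul_eq_mul_left_iff]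
    ring
  · refine mem_cubSpan 1 0 0 fun w => ?_
    simp [eval_sAct, hi, cub, dotProduct, Fin.sum_univ_three, -mul_eq_mul_left_iff]
    ring
  · refine mem_cubSpan 0 0 (-1) fun w => ?_
    simp [eval_sAct, hi, cub, dotProduct, Fin.sum_univ_three, -mul_eq_mul_left_iff]
    ring

lemma invUnder_icos {θ a h : ℝ} (hh : h ^ 2 = h + 1)
    (hP : polySet (Ptet θ) = cubSpan a (3 * (2 * h - 1) * a)) : InvUnder (icos h) (Ptet θ) := by
  have hi := Matrix.inv_eq_right_inv (icos_mul_self hh)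
  refine invUnder_of_involution (icos_mul_self hh) hP ?_ ?_ ?_
  · refine mem_cubSpan (-1 / 2) (-(h - 1) / 2) (-h / 2) fun w => ?_
    simp [eval_sAct, hi, cub, dotProduct, Fin.sum_univ_three]
    grind
  · refine mem_cubSpan (-(h - 1) / 2) (-h / 2) (1 / 2) fun w => ?_
    simp [eval_sAct, hi, cub, dotProduct, Fin.sum_univ_three]
    grind
  · refine mem_cubSpan (-h / 2) (1 / 2) ((h - 1) / 2) fun w => ?_
    simp [eval_sAct, hi, cub, dotProduct, Fin.sum_univ_three]
    grind

lemma TetSet_ssubset_stabSO3 {θ : ℝ} (hθ : Real.sin (3 * θ) = 0) :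
    TetSet ⊂ stabSO3 (Ptet θ) := by
  have h3 : √3 ^ 2 = 3 := Real.sq_sqrt (by norm_num)
  have h5 : √5 ^ 2 = 5 := Real.sq_sqrt (by norm_num)
  have hcs := Real.sin_sq_add_cos_sq θ
  have hsub : TetSet ⊆ stabSO3 (Ptet θ) := fun A hA =>
    ⟨TetSet_subset_SO3 hA, invUnder_of_mem_TetSet θ hA⟩
  rw [Set.ssubset_iff_of_subset hsub]
  have hicos {h : ℝ} (hh : h ^ 2 = h + 1)
      (hs : √15 / 5 * Real.sin θ = 3 * (2 * h - 1) * (Real.cos θ / 5)) :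
      ∃ A ∈ stabSO3 (Ptet θ), A ∉ TetSet := by
    refine ⟨icos h, ⟨icos_mem_SO3 hh, invUnder_icos (a := Real.cos θ / 5) hh ?_⟩, icos_notMem hh⟩
    rw [polySet_Ptet, hs]
  rw [Real.sin_three_mul] at hθ
  have hfac : Real.sin θ * ((Real.sin θ - √3 * Real.cos θ) *
      (Real.sin θ + √3 * Real.cos θ)) = 0 := by
    linear_combination -hθ - 3 * Real.sin θ * hcs - Real.sin θ * Real.cos θ ^ 2 * h3
  rcases mul_eq_zero.1 hfac with hs | hs
  · exact ⟨swapXY, ⟨swapXY_mem_SO3, invUnder_swapXY hs⟩, swapXY_notMem⟩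
  rcases mul_eq_zero.1 hs with hs | hs
  · refine hicos (h := (1 + √5) / 2) (by linear_combination h5 / 4) ?_
    rw [sqrt_fifteen]
    linear_combination √3 * √5 / 5 * hs + √5 * Real.cos θ / 5 * h3
  · refine hicos (h := (1 - √5) / 2) (by linear_combination h5 / 4) ?_
    rw [sqrt_fifteen]
    linear_combination √3 * √5 / 5 * hs - √5 * Real.cos θ / 5 * h3

/-- (i) each `P_θ` is a 3-dimensional `Tet`-invariant subspace;
(ii) every 3-dimensional `Tet`-invariant subspace of `H₃` is some `P_θ`;
(iii) `P_θ` is associative iff `θ ∈ (π/3)ℤ`;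
(iv) for such `θ` the `SO(3)`-stabiliser of `P_θ` strictly contains `Tet`; consequently no
3-dimensional associative subspace has `SO(3)`-stabiliser equal to `Tet`. -/
theorem stmt6 :
    (∀ θ : ℝ, Module.finrank ℝ (Ptet θ) = 3 ∧ ∀ A ∈ TetSet, InvUnder A (Ptet θ)) ∧
    (∀ E : Submodule ℝ (Fin 7 → ℝ), Module.finrank ℝ E = 3 →
      (∀ A ∈ TetSet, InvUnder A E) → ∃ θ : ℝ, E = Ptet θ) ∧
    (∀ θ : ℝ, IsAssocSubspace (Ptet θ) ↔ ∃ k : ℤ, θ = k * (Real.pi / 3)) ∧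
    (∀ θ : ℝ, (∃ k : ℤ, θ = k * (Real.pi / 3)) → TetSet ⊂ stabSO3 (Ptet θ)) ∧
    (∀ E : Submodule ℝ (Fin 7 → ℝ), IsAssocSubspace E → stabSO3 E ≠ TetSet) := by
  refine ⟨fun θ => ⟨finrank_Ptet θ, fun A hA => invUnder_of_mem_TetSet θ hA⟩,
    fun E hE hinv => eq_Ptet_of_invUnder hE hinv, isAssocSubspace_Ptet_iff,
    fun θ hθ => TetSet_ssubset_stabSO3 ((sin_three_mul_eq_zero_iff θ).2 hθ), ?_⟩
  intro E hE hstab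
  obtain ⟨θ, rfl⟩ := eq_Ptet_of_invUnder (finrank_of_isAssocSubspace hE)
    fun A hA => (hstab.symm ▸ hA : A ∈ stabSO3 E).2
  exact (TetSet_ssubset_stabSO3 ((isAssocSubspace_Ptet_iff_sin θ).1 hE)).ne hstab.symm
end
end

section
/- For all ψ, θ ∈ ℝ, the 3-dimensional subspace Q⁽⁴ᵇ⁾(ψ,θ) = span(cos ψ·e₄ + sin ψ·e₅, cos θ·e₂ + sin θ·e₇, cos θ·e₃ + sin θ·e₆) of H₃ is not associative. -/
noncomputable section

open MvPolynomial Matrix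

/-- `Q⁽⁴ᵇ⁾(ψ,θ) = span (cos ψ·e₄ + sin ψ·e₅, cos θ·e₂ + sin θ·e₇, cos θ·e₃ + sin θ·e₆)`,
in coordinates. -/
def Q4b (ψ θ : ℝ) : Submodule ℝ (Fin 7 → ℝ) :=
  Submodule.span ℝ
    {![0, 0, 0, Real.cos ψ, Real.sin ψ, 0, 0],
      ![0, Real.cos θ, 0, 0, 0, 0, Real.sin θ],
      ![0, 0, Real.cos θ, 0, 0, Real.sin θ, 0]}

/-- The three spanning vectors of `Q⁽⁴ᵇ⁾(ψ,θ)`, as a family. -/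
def Q4bGen (ψ θ : ℝ) : Fin 3 → Fin 7 → ℝ :=
  ![![0, 0, 0, Real.cos ψ, Real.sin ψ, 0, 0],
    ![0, Real.cos θ, 0, 0, 0, 0, Real.sin θ],
    ![0, 0, Real.cos θ, 0, 0, Real.sin θ, 0]]

theorem Q4b_eq_span_range (ψ θ : ℝ) :
    Q4b ψ θ = Submodule.span ℝ (Set.range (Q4bGen ψ θ)) := by
  unfold Q4b
  congr 1
  ext v
  simp [Q4bGen]
  tauto

theorem eq_zero_of_mul_cos_of_mul_sin {a t : ℝ} (hc : a * Real.cos t = 0)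
    (hs : a * Real.sin t = 0) : a = 0 := by
  linear_combination Real.cos t * hc + Real.sin t * hs - a * Real.sin_sq_add_cos_sq t

theorem linearIndependent_Q4bGen (ψ θ : ℝ) : LinearIndependent ℝ (Q4bGen ψ θ) := by
  rw [Fintype.linearIndependent_iff]
  intro g hg
  have h (j : Fin 7) := congrFun hg j
  simp only [Fin.sum_univ_three, Q4bGen] at h
  intro i
  fin_cases i
  · exact eq_zero_of_mul_cos_of_mul_sin (t := ψ) (by simpa using h 3) (by simpa using h 4)
  · exact eq_zero_of_mul_cos_of_mul_sin (t := θ) (by simpa using h 1) (by simpa using h 6)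
  · exact eq_zero_of_mul_cos_of_mul_sin (t := θ) (by simpa using h 2) (by simpa using h 5)

/-- The 3-form `φ₀` vanishes identically on `Q⁽⁴ᵇ⁾(ψ,θ)`. -/
theorem phi0_eq_zero_of_mem_Q4b {ψ θ : ℝ} {u v w : Fin 7 → ℝ} (hu : u ∈ Q4b ψ θ)
    (hv : v ∈ Q4b ψ θ) (hw : w ∈ Q4b ψ θ) : phi0 u v w = 0 := by
  obtain ⟨a, b, c, rfl⟩ := Submodule.mem_span_triple.1 hu
  obtain ⟨a', b', c', rfl⟩ := Submodule.mem_span_triple.1 hv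
  obtain ⟨a'', b'', c'', rfl⟩ := Submodule.mem_span_triple.1 hw
  simp [phi0, triD, Matrix.det_fin_three]
  ring

/-- No `Q⁽⁴ᵇ⁾(ψ,θ)` (a 3-dimensional subspace of `H₃`) is associative. -/
theorem stmt9 (ψ θ : ℝ) :
    Module.finrank ℝ (Q4b ψ θ) = 3 ∧ ¬ IsAssocSubspace (Q4b ψ θ) := by
  constructor
  · rw [Q4b_eq_span_range, finrank_span_eq_card (linearIndependent_Q4bGen ψ θ), Fintype.card_fin]
  · rintro ⟨u, v, w, hu, hv, hw, -, -, -, -, -, -, -, h⟩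
    simp [phi0_eq_zero_of_mem_Q4b hu hv hw] at h
end
end

section
/- Let θ ∈ ℝ and let a = (a₁, a₆, a₇) ∈ ℝ³ be a unit vector. Then the 3-dimensional subspace Q⁽³⁾(θ, a) = span(a₁e₁ + a₆e₆ + a₇e₇, cos θ·e₂ + sin θ·e₅, cos θ·e₃ + sin θ·e₄) of H₃ is associative if and only if a = (cos 2θ, sin 2θ, 0) or a = −(cos 2θ, sin 2θ, 0). -/
noncomputable section

open MvPolynomial Matrix

/-- `Q⁽³⁾(θ, a) = span (a₁e₁ + a₆e₆ + a₇e₇, cos θ·e₂ + sin θ·e₅, cos θ·e₃ + sin θ·e₄)`,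
in coordinates, for `a = (a₁, a₆, a₇)`. -/
def Q3 (θ : ℝ) (a : Fin 3 → ℝ) : Submodule ℝ (Fin 7 → ℝ) :=
  Submodule.span ℝ
    {![a 0, 0, 0, 0, 0, a 1, a 2],
      ![0, Real.cos θ, 0, 0, Real.sin θ, 0, 0],
      ![0, 0, Real.cos θ, Real.sin θ, 0, 0, 0]}

/-- `dot7` of two linear combinations of an orthonormal triple. -/
theorem dot7_combination {f g h : Fin 7 → ℝ} (hff : dot7 f f = 1) (hgg : dot7 g g = 1)
    (hhh : dot7 h h = 1) (hfg : dot7 f g = 0) (hfh : dot7 f h = 0) (hgh : dot7 g h = 0)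
    (p q r p' q' r' : ℝ) :
    dot7 (p • f + q • g + r • h) (p' • f + q' • g + r' • h) = p * p' + q * q' + r * r' := by
  change f ⬝ᵥ f = 1 at hff
  change g ⬝ᵥ g = 1 at hgg
  change h ⬝ᵥ h = 1 at hhh
  change f ⬝ᵥ g = 0 at hfg
  change f ⬝ᵥ h = 0 at hfh
  change g ⬝ᵥ h = 0 at hgh
  change (p • f + q • g + r • h) ⬝ᵥ (p' • f + q' • g + r' • h) = _
  simp only [add_dotProduct, dotProduct_add, smul_dotProduct, dotProduct_smul, smul_eq_mul,
    dotProduct_comm g f, dotProduct_comm h f, dotProduct_comm h g, hff, hgg, hhh, hfg, hfh, hgh]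
  ring

/-- Change of basis multiplies `triD` by the determinant. -/
theorem triD_combination (f g h : Fin 7 → ℝ) (M : Matrix (Fin 3) (Fin 3) ℝ) (i j k : Fin 7) :
    triD (M 0 0 • f + M 0 1 • g + M 0 2 • h) (M 1 0 • f + M 1 1 • g + M 1 2 • h)
      (M 2 0 • f + M 2 1 • g + M 2 2 • h) i j k = M.det * triD f g h i j k := by
  unfold triD
  rw [← det_mul]
  congr 1
  ext a b
  fin_cases a <;> fin_cases b <;> simp [Matrix.mul_apply, Fin.sum_univ_three]

/-- Change of basis multiplies `phi0` by the determinant. -/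
theorem phi0_combination (f g h : Fin 7 → ℝ) (M : Matrix (Fin 3) (Fin 3) ℝ) :
    phi0 (M 0 0 • f + M 0 1 • g + M 0 2 • h) (M 1 0 • f + M 1 1 • g + M 1 2 • h)
      (M 2 0 • f + M 2 1 • g + M 2 2 • h) = M.det * phi0 f g h := by
  simp only [phi0, triD_combination]
  ring

/-- Associativity of a 3-plane can be tested on any given orthonormal basis. -/
theorem isAssocSubspace_span_iff {f g h : Fin 7 → ℝ} (hff : dot7 f f = 1) (hgg : dot7 g g = 1)
    (hhh : dot7 h h = 1) (hfg : dot7 f g = 0) (hfh : dot7 f h = 0) (hgh : dot7 g h = 0) :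
    IsAssocSubspace (Submodule.span ℝ {f, g, h}) ↔ phi0 f g h = 1 ∨ phi0 f g h = -1 := by
  constructor
  · rintro ⟨u, v, w, hu, hv, hw, huu, hvv, hww, huv, huw, hvw, -, hphi⟩
    obtain ⟨p₀, q₀, r₀, rfl⟩ := Submodule.mem_span_triple.1 hu
    obtain ⟨p₁, q₁, r₁, rfl⟩ := Submodule.mem_span_triple.1 hv
    obtain ⟨p₂, q₂, r₂, rfl⟩ := Submodule.mem_span_triple.1 hw
    simp only [dot7_combination hff hgg hhh hfg hfh hgh] at huu hvv hww huv huw hvw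
    let M : Matrix (Fin 3) (Fin 3) ℝ := !![p₀, q₀, r₀; p₁, q₁, r₁; p₂, q₂, r₂]
    have hM : M * Mᵀ = 1 := by
      ext a b
      fin_cases a <;> fin_cases b <;>
        simp [M, Matrix.mul_apply, Fin.sum_univ_three] <;> linarith
    have hdet : M.det * M.det = 1 := by
      simpa using congrArg Matrix.det hM
    have hcomb := phi0_combination f g h M
    simp only [M, of_apply, cons_val] at hcomb
    rw [hcomb] at hphi
    change M.det * _ = 1 ∨ M.det * _ = -1 at hphi
    rcases mul_self_eq_one_iff.1 hdet with h1 | h1 <;> rw [h1] at hphi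
    · simpa using hphi
    · rcases hphi with h2 | h2
      · right; linarith
      · left; linarith
  · intro hphi
    exact ⟨f, g, h, Submodule.subset_span (by simp), Submodule.subset_span (by simp),
      Submodule.subset_span (by simp), hff, hgg, hhh, hfg, hfh, hgh, rfl, hphi⟩

/-- The value of `phi0` on the spanning triple of `Q3 θ a`. -/
theorem phi0_Q3 (θ : ℝ) (a : Fin 3 → ℝ) :
    phi0 ![a 0, 0, 0, 0, 0, a 1, a 2] ![0, Real.cos θ, 0, 0, Real.sin θ, 0, 0]
      ![0, 0, Real.cos θ, Real.sin θ, 0, 0, 0] =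
      a 0 * Real.cos (2 * θ) + a 1 * Real.sin (2 * θ) := by
  simp only [phi0, triD, det_fin_three, of_apply, cons_val, Real.cos_two_mul', Real.sin_two_mul]
  ring

/-- The equality case of the Cauchy–Schwarz inequality for two unit vectors. -/
theorem eq_of_inner_eq_one {a : Fin 3 → ℝ} (ha : a 0 ^ 2 + a 1 ^ 2 + a 2 ^ 2 = 1) {c s : ℝ}
    (hcs : s ^ 2 + c ^ 2 = 1) (h : a 0 * c + a 1 * s = 1) : a = ![c, s, 0] := by
  have h0 : a 0 - c = 0 := by
    nlinarith [sq_nonneg (a 0 - c), sq_nonneg (a 1 - s), sq_nonneg (a 2)]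
  have h1 : a 1 - s = 0 := by
    nlinarith [sq_nonneg (a 0 - c), sq_nonneg (a 1 - s), sq_nonneg (a 2)]
  have h2 : a 2 = 0 := by
    nlinarith [sq_nonneg (a 0 - c), sq_nonneg (a 1 - s), sq_nonneg (a 2)]
  ext i
  fin_cases i <;> simp <;> linarith

/-- For a unit vector `a = (a₁, a₆, a₇)`, the subspace `Q⁽³⁾(θ, a)` is
associative if and only if `a = ±(cos 2θ, sin 2θ, 0)`. -/
theorem stmt10 (θ : ℝ) (a : Fin 3 → ℝ) (ha : a 0 ^ 2 + a 1 ^ 2 + a 2 ^ 2 = 1) :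
    IsAssocSubspace (Q3 θ a) ↔
      (a = ![Real.cos (2 * θ), Real.sin (2 * θ), 0] ∨
       a = -![Real.cos (2 * θ), Real.sin (2 * θ), 0]) := by
  have hcs := Real.sin_sq_add_cos_sq (2 * θ)
  have hθ := Real.sin_sq_add_cos_sq θ
  rw [Q3, isAssocSubspace_span_iff, phi0_Q3]
  · constructor
    · rintro (h | h)
      · exact .inl (eq_of_inner_eq_one ha hcs h)
      · refine .inr (neg_eq_iff_eq_neg.1 (eq_of_inner_eq_one ?_ hcs ?_))
        · simpa using ha
        · simp only [Pi.neg_apply]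
          linarith
    · rintro (rfl | rfl)
      · left
        simp only [cons_val]
        linarith
      · right
        simp only [Pi.neg_apply, cons_val]
        linarith
  all_goals simp [dot7, Fin.sum_univ_succ] <;> linarith
end
end

section
/- For a unit vector u ∈ S², one has M(ν(u)) = (3/2)·uuᵀ − (1/2)·I₃. Moreover, for v ∈ ℝ⁵ with |v| = 1, the following are equivalent: (i) v ∈ Σ₀; (ii) det(M(v) + (1/2)·I₃) = 0 (i.e. −1/2 is an eigenvalue of M(v)); (iii) the eigenvalues of M(v) are 1, −1/2, −1/2. -/
noncomputable section

open Matrix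

/-- The linear isomorphism of `ℝ⁵` with the traceless symmetric 3×3 matrices:
`M(v) = (1/2)·[[2v₁, √3v₂, √3v₃], [√3v₂, −v₁+√3v₄, √3v₅], [√3v₃, √3v₅, −v₁−√3v₄]]`. -/
def Mmat (v : Fin 5 → ℝ) : Matrix (Fin 3) (Fin 3) ℝ :=
  (1 / 2 : ℝ) •
    !![2 * v 0, Real.sqrt 3 * v 1, Real.sqrt 3 * v 2;
       Real.sqrt 3 * v 1, -v 0 + Real.sqrt 3 * v 3, Real.sqrt 3 * v 4;
       Real.sqrt 3 * v 2, Real.sqrt 3 * v 4, -v 0 - Real.sqrt 3 * v 3]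

/-- The Veronese map `ν : S² → ℝ⁵`. -/
def nuV (u : Fin 3 → ℝ) : Fin 5 → ℝ :=
  ![u 0 ^ 2 - u 1 ^ 2 / 2 - u 2 ^ 2 / 2,
    Real.sqrt 3 * u 0 * u 1,
    Real.sqrt 3 * u 0 * u 2,
    (Real.sqrt 3 / 2) * (u 1 ^ 2 - u 2 ^ 2),
    Real.sqrt 3 * u 1 * u 2]

/-- The standard Veronese surface `Σ₀ = ν(S²) ⊆ ℝ⁵`. -/
def Sigma0 : Set (Fin 5 → ℝ) :=
  {v | ∃ u : Fin 3 → ℝ, (∑ i, u i ^ 2) = 1 ∧ nuV u = v}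

theorem Mmat_nuV (u : Fin 3 → ℝ) (hu : (∑ i, u i ^ 2) = 1) :
    Mmat (nuV u) = (3 / 2 : ℝ) • vecMulVec u u - (1 / 2 : ℝ) • 1 := by
  have h3 : Real.sqrt 3 * Real.sqrt 3 = 3 := Real.mul_self_sqrt (by norm_num)
  rw [Fin.sum_univ_three] at hu
  ext i j
  fin_cases i <;> fin_cases j <;> simp [Mmat, nuV, vecMulVec_apply, one_apply]
  · linear_combination (-1 / 2) * hu
  · linear_combination (1 / 2) * u 0 * u 1 * h3
  · linear_combination (1 / 2) * u 0 * u 2 * h3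
  · linear_combination (1 / 2) * u 0 * u 1 * h3
  · linear_combination (-1 / 2) * hu + (1 / 4) * (u 1 ^ 2 - u 2 ^ 2) * h3
  · linear_combination (1 / 2) * u 1 * u 2 * h3
  · linear_combination (1 / 2) * u 0 * u 2 * h3
  · linear_combination (1 / 2) * u 1 * u 2 * h3
  · linear_combination (-1 / 2) * hu - (1 / 4) * (u 1 ^ 2 - u 2 ^ 2) * h3

theorem Mmat_injective : Function.Injective Mmat := by
  intro v w h
  have h0 : Real.sqrt 3 ≠ 0 := by positivity
  have e0 := congrFun (congrFun h 0) 0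
  have e1 := congrFun (congrFun h 0) 1
  have e2 := congrFun (congrFun h 0) 2
  have e3 := congrFun (congrFun h 1) 1
  have e4 := congrFun (congrFun h 1) 2
  simp [Mmat] at e0 e1 e2 e3 e4
  ext i
  fin_cases i
  · exact e0
  · exact e1
  · exact e2
  · simpa [e0] using e3
  · exact e4

/-- A real matrix whose `2 × 2` minors vanish, with symmetric entries and positive trace,
is of the form `u uᵀ`. -/
theorem exists_eq_vecMulVec_self {n : Type*} [Fintype n] (P : Matrix n n ℝ) (hP : P.IsSymm)
    (hm : ∀ i j k l, P i j * P k l = P i l * P k j) (ht : 0 < P.trace) :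
    ∃ u : n → ℝ, P = vecMulVec u u := by
  obtain ⟨i, -, hi⟩ : ∃ i ∈ Finset.univ, 0 < P i i := by
    by_contra! h
    exact absurd ht (not_lt.mpr (Finset.sum_nonpos h))
  refine ⟨fun j => P j i / Real.sqrt (P i i), ?_⟩
  ext j k
  rw [vecMulVec_apply, div_mul_div_comm, Real.mul_self_sqrt hi.le, eq_div_iff hi.ne',
    hm j k i i, hP.apply k i]

/-- A real symmetric `3 × 3` matrix with `det N = 0` and `(tr N)² = tr N²` has vanishing
`2 × 2` minors. -/
theorem minors_eq_zero (N : Matrix (Fin 3) (Fin 3) ℝ) (hN : N.IsSymm) (hdet : N.det = 0)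
    (htr : N.trace ^ 2 = ∑ i, ∑ j, N i j ^ 2) (i j k l : Fin 3) :
    N i j * N k l = N i l * N k j := by
  have s1 := hN.apply 0 1
  have s2 := hN.apply 0 2
  have s3 := hN.apply 1 2
  rw [det_fin_three] at hdet
  simp only [trace_fin_three, Fin.sum_univ_three] at htr
  rw [s1, s2, s3] at hdet htr
  generalize ha : N 0 0 = a at *
  generalize hb : N 0 1 = b at *
  generalize hc : N 0 2 = c at *
  generalize hd : N 1 1 = d at *
  generalize he : N 1 2 = e at *
  generalize hf : N 2 2 = f at *
  have hs : (a * d - b ^ 2) ^ 2 + (a * f - c ^ 2) ^ 2 + (d * f - e ^ 2) ^ 2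
      + 2 * (b * f - c * e) ^ 2 + 2 * (a * e - b * c) ^ 2 + 2 * (b * e - c * d) ^ 2 = 0 := by
    linear_combination (1 / 2) * (a * d - b ^ 2 + a * f - c ^ 2 + d * f - e ^ 2) * htr
      - 2 * (a + d + f) * hdet
  have q1 := sq_nonneg (a * d - b ^ 2)
  have q2 := sq_nonneg (a * f - c ^ 2)
  have q3 := sq_nonneg (d * f - e ^ 2)
  have q4 := sq_nonneg (b * f - c * e)
  have q5 := sq_nonneg (a * e - b * c)
  have q6 := sq_nonneg (b * e - c * d)
  have m1 : a * d - b ^ 2 = 0 := by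
    rw [← sq_eq_zero_iff]
    linarith
  have m2 : a * f - c ^ 2 = 0 := by
    rw [← sq_eq_zero_iff]
    linarith
  have m3 : d * f - e ^ 2 = 0 := by
    rw [← sq_eq_zero_iff]
    linarith
  have m4 : b * f - c * e = 0 := by
    rw [← sq_eq_zero_iff]
    linarith
  have m5 : a * e - b * c = 0 := by
    rw [← sq_eq_zero_iff]
    linarith
  have m6 : b * e - c * d = 0 := by
    rw [← sq_eq_zero_iff]
    linarith
  fin_cases i <;> fin_cases j <;> fin_cases k <;> fin_cases l <;>
    simp only [Fin.zero_eta, Fin.mk_one, Fin.reduceFinMk, s1, s2, s3, ha, hb, hc, hd, he, hf] <;>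
    linarith

theorem charpoly_Mmat_nuV (u : Fin 3 → ℝ) (hu : (∑ i, u i ^ 2) = 1) :
    (Mmat (nuV u)).charpoly =
      (Polynomial.X - Polynomial.C 1) * (Polynomial.X + Polynomial.C (1 / 2)) ^ 2 := by
  apply Polynomial.funext
  intro t
  rw [eval_charpoly, Mmat_nuV u hu, det_fin_three]
  rw [Fin.sum_univ_three] at hu
  simp [vecMulVec_apply, one_apply]
  linear_combination (-3 / 2) * (t + 1 / 2) ^ 2 * hu

theorem det_eq_zero_of_charpoly_eq {v : Fin 5 → ℝ} (h : (Mmat v).charpoly =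
      (Polynomial.X - Polynomial.C 1) * (Polynomial.X + Polynomial.C (1 / 2)) ^ 2) :
    (Mmat v + (1 / 2 : ℝ) • 1).det = 0 := by
  have h' := congrArg (Polynomial.eval (-1 / 2)) h
  rw [eval_charpoly] at h'
  have e : Mmat v + (1 / 2 : ℝ) • 1 = -(scalar (Fin 3) (-1 / 2 : ℝ) - Mmat v) := by
    rw [neg_sub, sub_eq_add_neg, ← map_neg, scalar_apply, ← smul_one_eq_diagonal]
    norm_num
  rw [e, det_neg, h']
  norm_num

theorem mem_Sigma0_of_det_eq_zero {v : Fin 5 → ℝ} (hv : (∑ i, v i ^ 2) = 1)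
    (h : (Mmat v + (1 / 2 : ℝ) • 1).det = 0) : v ∈ Sigma0 := by
  have h3 : Real.sqrt 3 ^ 2 = 3 := Real.sq_sqrt (by norm_num)
  have hS : (Mmat v + (1 / 2 : ℝ) • 1).IsSymm := by
    apply IsSymm.ext
    intro i j
    fin_cases i <;> fin_cases j <;> simp [Mmat, one_apply]
  have ht : (Mmat v + (1 / 2 : ℝ) • 1).trace = 3 / 2 := by
    simp [trace_fin_three, Mmat]
    ring
  have hm := minors_eq_zero _ hS h (by
    rw [ht]
    simp [Fin.sum_univ_succ] at hv
    simp [Fin.sum_univ_three, Mmat, one_apply]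
    linear_combination (-3 / 2) * hv - (1 / 2) * (v 1 ^ 2 + v 2 ^ 2 + v 3 ^ 2 + v 4 ^ 2) * h3)
  obtain ⟨u, hu⟩ := exists_eq_vecMulVec_self ((2 / 3 : ℝ) • (Mmat v + (1 / 2 : ℝ) • 1))
    (hS.smul _) (fun i j k l => by
      have hm' := hm i j k l
      generalize Mmat v + (1 / 2 : ℝ) • 1 = N at hm' ⊢
      simp only [Matrix.smul_apply, smul_eq_mul]
      linear_combination (4 / 9) * hm') (by rw [trace_smul, ht]; norm_num)
  have hu1 : (∑ i, u i ^ 2) = 1 := by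
    have := congrArg trace hu
    rw [trace_smul, ht, trace_vecMulVec] at this
    simp only [dotProduct, ← sq] at this
    rw [← this]
    norm_num
  refine ⟨u, hu1, Mmat_injective ?_⟩
  rw [Mmat_nuV u hu1, ← hu, smul_smul]
  norm_num

/-- For unit `u`, `M(ν(u)) = (3/2)uuᵀ − (1/2)I₃`; and for unit `v ∈ ℝ⁵`
the conditions (i) `v ∈ Σ₀`, (ii) `det(M(v) + (1/2)I₃) = 0` (i.e. `−1/2` is an eigenvalue of
`M(v)`), (iii) the eigenvalues of `M(v)` are `1, −1/2, −1/2` (expressed via the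
characteristic polynomial) are equivalent. -/
theorem stmt18 :
    (∀ u : Fin 3 → ℝ, (∑ i, u i ^ 2) = 1 →
      Mmat (nuV u) = (3 / 2 : ℝ) • Matrix.vecMulVec u u - (1 / 2 : ℝ) • 1) ∧
    (∀ v : Fin 5 → ℝ, (∑ i, v i ^ 2) = 1 →
      ((v ∈ Sigma0 ↔ (Mmat v + (1 / 2 : ℝ) • 1).det = 0) ∧
       (v ∈ Sigma0 ↔ (Mmat v).charpoly =
          (Polynomial.X - Polynomial.C 1) * (Polynomial.X + Polynomial.C (1 / 2)) ^ 2))) := by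
  refine ⟨Mmat_nuV, fun v hv => ?_⟩
  have hc : v ∈ Sigma0 → (Mmat v).charpoly =
      (Polynomial.X - Polynomial.C 1) * (Polynomial.X + Polynomial.C (1 / 2)) ^ 2 := by
    rintro ⟨u, hu, rfl⟩
    exact charpoly_Mmat_nuV u hu
  exact ⟨⟨fun h => det_eq_zero_of_charpoly_eq (hc h), mem_Sigma0_of_det_eq_zero hv⟩,
    ⟨hc, fun h => mem_Sigma0_of_det_eq_zero hv (det_eq_zero_of_charpoly_eq h)⟩⟩
end
end
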